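/- For every x = (x₁,x₂) ∈ ℝ² ∖ {(0,0)} with x₁ ≥ 0 one has ∂u/∂x₁(x) ≥ 2, and for every x = (x₁,x₂) with x₂ > 0 one has ∂u/∂x₂(x) > 0. In particular, along any gradient flow of u staying in the open first quadrant, both coordinates are strictly increasing. -/

import Mathlib

noncomputable section

/-- The potential `u(x₁,x₂) = C (x₁^{4k}/C + x₂²)^{1 - 1/(4k)} + 2 x₁`. -/
def uu (k : ℕ) (C : ℝ) (x : ℝ × ℝ) : ℝ :=
  C * (x.1 ^ (4 * k) / C + x.2 ^ 2) ^ ((1:ℝ) - 1 / (4 * (k:ℝ))) + 2 * x.1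

/-- The gradient of `u`, given by its two partial derivatives. -/
def gradU (k : ℕ) (C : ℝ) (x : ℝ × ℝ) : ℝ × ℝ :=
  (deriv (fun s => uu k C (s, x.2)) x.1, deriv (fun s => uu k C (x.1, s)) x.2)

/-- The base of the power in `uu` is positive away from the origin. -/
lemma uu_base_pos {k : ℕ} {C : ℝ} (hC : 0 < C) {x : ℝ × ℝ} (hx : x ≠ 0) :
    0 < x.1 ^ (4 * k) / C + x.2 ^ 2 := by
  have heven : Even (4 * k) := ⟨2 * k, by ring⟩
  have h1 : 0 ≤ x.1 ^ (4 * k) / C := div_nonneg (heven.pow_nonneg _) hC.le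
  by_cases h2 : x.2 = 0
  · have h3 : x.1 ≠ 0 := fun h => hx (Prod.ext h h2)
    have : 0 < x.1 ^ (4 * k) / C := div_pos (heven.pow_pos h3) hC
    positivity
  · positivity

lemma hasDerivAt_uu_fst {k : ℕ} {C : ℝ} (hC : 0 < C) {x : ℝ × ℝ} (hx : x ≠ 0) :
    HasDerivAt (fun s => uu k C (s, x.2))
      (C * (((4 * k : ℕ) * x.1 ^ (4 * k - 1) / C) * (1 - 1 / (4 * (k : ℝ))) *
        (x.1 ^ (4 * k) / C + x.2 ^ 2) ^ ((1 : ℝ) - 1 / (4 * (k : ℝ)) - 1)) + 2) x.1 := by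
  have hbase := ((hasDerivAt_pow (4 * k) x.1).div_const C).add_const (x.2 ^ 2)
  have hpow := hbase.rpow_const (p := (1 : ℝ) - 1 / (4 * (k : ℝ)))
    (Or.inl (uu_base_pos hC hx).ne')
  simpa [uu] using (hpow.const_mul C).fun_add ((hasDerivAt_id x.1).const_mul 2)

lemma hasDerivAt_uu_snd {k : ℕ} {C : ℝ} (hC : 0 < C) {x : ℝ × ℝ} (hx : x ≠ 0) :
    HasDerivAt (fun s => uu k C (x.1, s))
      (C * ((2 * x.2) * (1 - 1 / (4 * (k : ℝ))) *
        (x.1 ^ (4 * k) / C + x.2 ^ 2) ^ ((1 : ℝ) - 1 / (4 * (k : ℝ)) - 1))) x.2 := by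
  have hbase := (hasDerivAt_pow 2 x.2).const_add (x.1 ^ (4 * k) / C)
  have hpow := hbase.rpow_const (p := (1 : ℝ) - 1 / (4 * (k : ℝ)))
    (Or.inl (uu_base_pos hC hx).ne')
  simpa [uu] using (hpow.const_mul C).add_const (2 * x.1)

lemma one_sub_one_div_four_mul_pos {k : ℕ} (hk : 1 ≤ k) : (0 : ℝ) < 1 - 1 / (4 * (k : ℝ)) := by
  have hk' : (1 : ℝ) ≤ k := by exact_mod_cast hk
  rw [sub_pos, div_lt_one (by positivity)]
  linarith

lemma two_le_deriv_uu_fst {k : ℕ} (hk : 1 ≤ k) {C : ℝ} (hC : 0 < C) {x : ℝ × ℝ} (hx : x ≠ 0)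
    (h1 : 0 ≤ x.1) : 2 ≤ deriv (fun s => uu k C (s, x.2)) x.1 := by
  rw [(hasDerivAt_uu_fst hC hx).deriv]
  have hp := one_sub_one_div_four_mul_pos hk
  have hb := Real.rpow_pos_of_pos (uu_base_pos (k := k) hC hx)
    ((1 : ℝ) - 1 / (4 * (k : ℝ)) - 1)
  refine le_add_of_nonneg_left (mul_nonneg hC.le (mul_nonneg (mul_nonneg ?_ hp.le) hb.le))
  positivity

lemma deriv_uu_snd_pos {k : ℕ} (hk : 1 ≤ k) {C : ℝ} (hC : 0 < C) {x : ℝ × ℝ} (h2 : 0 < x.2) :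
    0 < deriv (fun s => uu k C (x.1, s)) x.2 := by
  have hx : x ≠ 0 := fun h => h2.ne' (by simp [h])
  rw [(hasDerivAt_uu_snd hC hx).deriv]
  have hp := one_sub_one_div_four_mul_pos hk
  have hb := Real.rpow_pos_of_pos (uu_base_pos (k := k) hC hx)
    ((1 : ℝ) - 1 / (4 * (k : ℝ)) - 1)
  exact mul_pos hC (mul_pos (mul_pos (by positivity) hp) hb)

lemma strictMonoOn_Icc_of_hasDerivWithinAt_pos {a b : ℝ} {f f' : ℝ → ℝ}
    (hf : ∀ t ∈ Set.Icc a b, HasDerivWithinAt f (f' t) (Set.Icc a b) t)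
    (hf' : ∀ t ∈ Set.Icc a b, 0 < f' t) : StrictMonoOn f (Set.Icc a b) :=
  strictMonoOn_of_hasDerivWithinAt_pos (convex_Icc a b)
    (fun t ht => (hf t ht).continuousWithinAt)
    (fun t ht => (hf t (interior_subset ht)).mono interior_subset)
    (fun t ht => hf' t (interior_subset ht))

/-- ∂₁u ≥ 2 when x₁ ≥ 0 and x ≠ 0; ∂₂u > 0 when x₂ > 0. In particular both coordinates of
a gradient flow of u staying in the open first quadrant are strictly increasing. -/
theorem partials_signs_and_monotonicity (k : ℕ) (hk : 1 ≤ k) (C : ℝ)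
    (hC : 2 * (k:ℝ) * (4 * (k:ℝ) + 1) < C) :
    (∀ x : ℝ × ℝ, x ≠ 0 → 0 ≤ x.1 → 2 ≤ deriv (fun s => uu k C (s, x.2)) x.1) ∧
    (∀ x : ℝ × ℝ, 0 < x.2 → 0 < deriv (fun s => uu k C (x.1, s)) x.2) ∧
    (∀ T₀ T₁ : ℝ, T₀ < T₁ → ∀ ξ : ℝ → ℝ × ℝ,
      (∀ t ∈ Set.Icc T₀ T₁, HasDerivWithinAt ξ (gradU k C (ξ t)) (Set.Icc T₀ T₁) t) →
      (∀ t ∈ Set.Icc T₀ T₁, 0 < (ξ t).1 ∧ 0 < (ξ t).2) →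
      StrictMonoOn (fun t => (ξ t).1) (Set.Icc T₀ T₁) ∧
        StrictMonoOn (fun t => (ξ t).2) (Set.Icc T₀ T₁)) := by
  have hC0 : 0 < C := lt_of_le_of_lt (by positivity) hC
  refine ⟨fun x hx h1 => two_le_deriv_uu_fst hk hC0 hx h1,
    fun x h2 => deriv_uu_snd_pos hk hC0 h2, fun T₀ T₁ _ ξ hξ hpos => ⟨?_, ?_⟩⟩
  · refine strictMonoOn_Icc_of_hasDerivWithinAt_pos (f' := fun t => (gradU k C (ξ t)).1)
      (fun t ht => (ContinuousLinearMap.fst ℝ ℝ ℝ).hasFDerivAt.comp_hasDerivWithinAt t (hξ t ht))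
      fun t ht => ?_
    have hne : ξ t ≠ 0 := fun h => (hpos t ht).1.ne' (by simp [h])
    exact two_pos.trans_le (two_le_deriv_uu_fst hk hC0 hne (hpos t ht).1.le)
  · exact strictMonoOn_Icc_of_hasDerivWithinAt_pos (f' := fun t => (gradU k C (ξ t)).2)
      (fun t ht => (ContinuousLinearMap.snd ℝ ℝ ℝ).hasFDerivAt.comp_hasDerivWithinAt t (hξ t ht))
      fun t ht => deriv_uu_snd_pos hk hC0 (hpos t ht).2
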